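/- Suppose either 0 < α < 1/4 and s < 3/4, or 1/4 < α < 5/12 and s < 5/6 − α. Then there exist ε > 0 and C > 0, depending only on α and s, such that the following holds for all signs σ₁₂₃₄₅, σ₂₃₄, σ₁, σ₂, σ₃, σ₄, σ₅ ∈ {−1, 1}, all dyadic numbers N₁, …, N₅, and all m, m' ∈ ℤ. Writing n₂₃₄ := n₂+n₃+n₄ and n₁₂₃₄₅ := n₁+n₂+n₃+n₄+n₅, define for (n₁,…,n₅) ∈ (ℤ²)⁵ the phases φ := σ₂₃₄·⟨n₂₃₄⟩ + σ₂·⟨n₂⟩ + σ₃·⟨n₃⟩ + σ₄·⟨n₄⟩, φ̃ := σ₁₂₃₄₅·⟨n₁₂₃₄₅⟩ + σ₂₃₄·⟨n₂₃₄⟩ + σ₁·⟨n₁⟩ + σ₅·⟨n₅⟩, and φ̂ := σ₁₂₃₄₅·⟨n₁₂₃₄₅⟩ + σ₂₃₄·⟨n₂₃₄⟩ + σ₁·⟨n₁⟩ + σ₂·⟨n₂⟩ + σ₃·⟨n₃⟩ + σ₄·⟨n₄⟩ + σ₅·⟨n₅⟩. Then ∑_{n₁,…,n₅ ∈ ℤ²}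 ⟨n₁₂₃₄₅⟩^{2(s−1)} · ⟨n₂₃₄⟩^{−2} · ∏_{j=1}^{5} [ 1_{|n_j| ∼ N_j} · ⟨n_j⟩^{−2+2α} ] · 1_{|φ − m| ≤ 1} · ( 1_{|φ̃ − m'| ≤ 1} + 1_{|φ̂ − m'| ≤ 1} ) ≤ C · max(N₁, N₂, N₃, N₄, N₅)^{−ε}. -/

import Mathlib

/-- The Euclidean norm of a lattice point `x ∈ ℤ²`. -/
noncomputable def znorm (x : Fin 2 → ℤ) : ℝ :=
  Real.sqrt ((x 0 : ℝ) ^ 2 + (x 1 : ℝ) ^ 2)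

/-- The Japanese bracket `⟨x⟩ = √(1 + |x|²)` for lattice points `x ∈ ℤ²`. -/
noncomputable def jb (x : Fin 2 → ℤ) : ℝ :=
  Real.sqrt (1 + (x 0 : ℝ) ^ 2 + (x 1 : ℝ) ^ 2)

/-- `|x| ∼ N`, i.e. `N/2 ≤ |x| ≤ 2N`. -/
def ann (N : ℝ) (x : Fin 2 → ℤ) : Prop :=
  N / 2 ≤ znorm x ∧ znorm x ≤ 2 * N

/-- Sum `n₂₃₄ = n₂ + n₃ + n₄` of a quintuple `v = (n₁,…,n₅)`. -/
def sum234 (v : Fin 5 → Fin 2 → ℤ) : Fin 2 → ℤ := v 1 + v 2 + v 3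

/-- Sum `n₁₂₃₄₅ = n₁ + n₂ + n₃ + n₄ + n₅` of a quintuple `v = (n₁,…,n₅)`. -/
def sum12345 (v : Fin 5 → Fin 2 → ℤ) : Fin 2 → ℤ := v 0 + v 1 + v 2 + v 3 + v 4

/-- The phase `φ = σ₂₃₄⟨n₂₃₄⟩ + σ₂⟨n₂⟩ + σ₃⟨n₃⟩ + σ₄⟨n₄⟩`; here `σv j` is the sign
attached to `n_{j+1}`. -/
noncomputable def quinticPhase1 (σ₂₃₄ : ℝ) (σv : Fin 5 → ℝ) (v : Fin 5 → Fin 2 → ℤ) : ℝ :=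
  σ₂₃₄ * jb (sum234 v) + σv 1 * jb (v 1) + σv 2 * jb (v 2) + σv 3 * jb (v 3)

/-- The phase `φ̃ = σ₁₂₃₄₅⟨n₁₂₃₄₅⟩ + σ₂₃₄⟨n₂₃₄⟩ + σ₁⟨n₁⟩ + σ₅⟨n₅⟩`. -/
noncomputable def quinticPhase2 (σ₁₂₃₄₅ σ₂₃₄ : ℝ) (σv : Fin 5 → ℝ)
    (v : Fin 5 → Fin 2 → ℤ) : ℝ :=
  σ₁₂₃₄₅ * jb (sum12345 v) + σ₂₃₄ * jb (sum234 v) + σv 0 * jb (v 0) + σv 4 * jb (v 4)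

/-- The phase `φ̂ = σ₁₂₃₄₅⟨n₁₂₃₄₅⟩ + σ₂₃₄⟨n₂₃₄⟩ + ∑_{j=1}^{5} σⱼ⟨nⱼ⟩`. -/
noncomputable def quinticPhase3 (σ₁₂₃₄₅ σ₂₃₄ : ℝ) (σv : Fin 5 → ℝ)
    (v : Fin 5 → Fin 2 → ℤ) : ℝ :=
  σ₁₂₃₄₅ * jb (sum12345 v) + σ₂₃₄ * jb (sum234 v) + ∑ j, σv j * jb (v j)

theorem jb_pos (x : Fin 2 → ℤ) : 0 < jb x := Real.sqrt_pos.2 (by positivity)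

theorem jb_sq (x : Fin 2 → ℤ) : jb x ^ 2 = 1 + (x 0 : ℝ) ^ 2 + (x 1 : ℝ) ^ 2 :=
  Real.sq_sqrt (by positivity)

theorem one_le_jb (x : Fin 2 → ℤ) : 1 ≤ jb x :=
  Real.one_le_sqrt.2 (by nlinarith [sq_nonneg (x 0 : ℝ), sq_nonneg (x 1 : ℝ)])

theorem znorm_nonneg (x : Fin 2 → ℤ) : 0 ≤ znorm x := Real.sqrt_nonneg _

theorem znorm_sq (x : Fin 2 → ℤ) : znorm x ^ 2 = (x 0 : ℝ) ^ 2 + (x 1 : ℝ) ^ 2 :=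
  Real.sq_sqrt (by positivity)

theorem znorm_le_jb (x : Fin 2 → ℤ) : znorm x ≤ jb x :=
  Real.sqrt_le_sqrt (by linarith)

theorem jb_le_znorm_add_one (x : Fin 2 → ℤ) : jb x ≤ znorm x + 1 :=
  abs_le_of_sq_le_sq' (by nlinarith [jb_sq x, znorm_sq x, znorm_nonneg x])
    (by linarith [znorm_nonneg x]) |>.2

theorem jb_neg (x : Fin 2 → ℤ) : jb (-x) = jb x := by simp [jb]

theorem one_le_znorm {x : Fin 2 → ℤ} (hx : x ≠ 0) : 1 ≤ znorm x := by
  refine Real.one_le_sqrt.2 ?_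
  have h : 1 ≤ x 0 ^ 2 + x 1 ^ 2 := by
    by_contra! hlt
    have h0 : x 0 = 0 := by nlinarith [sq_nonneg (x 0), sq_nonneg (x 1)]
    have h1 : x 1 = 0 := by nlinarith [sq_nonneg (x 0), sq_nonneg (x 1)]
    exact hx (by ext i; fin_cases i <;> simp [h0, h1])
  exact_mod_cast h

theorem jb_add_le_jb_add_znorm (x y : Fin 2 → ℤ) : jb (x + y) ≤ jb x + znorm y := by
  have hc : (x 0 : ℝ) * y 0 + x 1 * y 1 ≤ jb x * znorm y := by
    refine (abs_le_of_sq_le_sq' ?_ (mul_nonneg (jb_pos x).le (znorm_nonneg y))).2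
    rw [mul_pow, jb_sq, znorm_sq]
    nlinarith [sq_nonneg ((x 0 : ℝ) * y 1 - x 1 * y 0), sq_nonneg (y 0 : ℝ), sq_nonneg (y 1 : ℝ)]
  refine (abs_le_of_sq_le_sq' ?_ (add_nonneg (jb_pos x).le (znorm_nonneg y))).2
  have := jb_sq (x + y)
  simp only [Pi.add_apply, Int.cast_add] at this
  nlinarith [jb_sq x, znorm_sq y]

theorem jb_add_le (x y : Fin 2 → ℤ) : jb (x + y) ≤ jb x + jb y :=
  (jb_add_le_jb_add_znorm x y).trans (by linarith [znorm_le_jb y])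

theorem jb_sub_comm (x y : Fin 2 → ℤ) : jb (x - y) = jb (y - x) := by
  rw [← jb_neg, neg_sub]

theorem jb_sub_le_znorm_add_jb (q n : Fin 2 → ℤ) : jb (q - n) ≤ znorm q + jb n := by
  have := jb_add_le_jb_add_znorm (-n) q
  rw [jb_neg, neg_add_eq_sub] at this
  linarith

theorem jb_le_znorm_add_jb_sub (q n : Fin 2 → ℤ) : jb n ≤ znorm q + jb (q - n) := by
  simpa using jb_sub_le_znorm_add_jb q (q - n)

theorem ann.jb_le {N : ℝ} (hN : 1 ≤ N) {x : Fin 2 → ℤ} (h : ann N x) : jb x ≤ 3 * N := by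
  linarith [jb_le_znorm_add_one x, h.2]

/-- If `g` oscillates by at most `D` on `S`, then `S` splits into `D / R + 1` pieces on which `g`
oscillates by at most `R`. -/
theorem card_le_of_windows {ι : Type*} (S : Finset ι) (g : ι → ℝ) {D R B : ℝ} (hR : 0 < R)
    (hD0 : 0 ≤ D) (hD : ∀ x ∈ S, ∀ y ∈ S, g x - g y ≤ D)
    (hB : ∀ T ⊆ S, (∀ x ∈ T, ∀ y ∈ T, g x - g y ≤ R) → (T.card : ℝ) ≤ B) :
    (S.card : ℝ) ≤ (D / R + 1) * B := by
  classical
  have hB0 : 0 ≤ B := by simpa using hB ∅ (by simp) (by simp)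
  rcases S.eq_empty_or_nonempty with rfl | hS
  · simpa using mul_nonneg (by positivity) hB0
  obtain ⟨x₀, hx₀, hmin⟩ := S.exists_min_image g hS
  have hmaps : ∀ x ∈ S, ⌊(g x - g x₀) / R⌋₊ ∈ Finset.range (⌊D / R⌋₊ + 1) := by
    intro x hx
    rw [Finset.mem_range, Nat.lt_succ_iff]
    exact Nat.floor_le_floor (div_le_div_of_nonneg_right (hD x hx x₀ hx₀) hR.le)
  rw [Finset.card_eq_sum_card_fiberwise hmaps]
  push_cast
  calc _ ≤ ∑ _i ∈ Finset.range (⌊D / R⌋₊ + 1), B := by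
        refine Finset.sum_le_sum fun i _ => hB _ (Finset.filter_subset _ _) ?_
        intro x hx y hy
        simp only [Finset.mem_filter] at hx hy
        have h1 := Nat.lt_floor_add_one ((g x - g x₀) / R)
        have h2 := Nat.floor_le (div_nonneg (sub_nonneg.2 (hmin y hy.1)) hR.le)
        rw [hx.2] at h1
        rw [hy.2] at h2
        rw [div_lt_iff₀ hR] at h1
        rw [le_div_iff₀ hR] at h2
        nlinarith
    _ = (⌊D / R⌋₊ + 1) * B := by simp
    _ ≤ (D / R + 1) * B := by
        gcongr
        exact Nat.floor_le (by positivity)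

/-- Lattice points in a rotated rectangle. -/
theorem card_le_of_rectangle (S : Finset (Fin 2 → ℤ)) {u w W H : ℝ} (hu : u ^ 2 + w ^ 2 = 1)
    (hW : 0 ≤ W) (hH : 0 ≤ H)
    (hx : ∀ n ∈ S, ∀ k ∈ S, (u * n 0 + w * n 1) - (u * k 0 + w * k 1) ≤ W)
    (hy : ∀ n ∈ S, ∀ k ∈ S, (-w * n 0 + u * n 1) - (-w * k 0 + u * k 1) ≤ H) :
    (S.card : ℝ) ≤ 16 * (W + 1) * (H + 1) := by
  have key : (S.card : ℝ) ≤ (W / 1 + 1) * ((H / 1 + 1) * ((3 / 2 / (1 / 2) + 1) *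
      ((3 / 2 / (1 / 2) + 1) * 1))) := by
    refine card_le_of_windows S (fun n => u * n 0 + w * n 1) one_pos hW hx fun T hT hTx => ?_
    refine card_le_of_windows T (fun n => -w * n 0 + u * n 1) one_pos hH
      (fun n hn k hk => hy n (hT hn) k (hT hk)) fun T' hT' hTy => ?_
    have hdist : ∀ n ∈ T', ∀ k ∈ T', ((n 0 : ℝ) - k 0) ^ 2 + ((n 1 : ℝ) - k 1) ^ 2 ≤ 2 := by
      intro n hn k hk
      have h1 := hTx n (hT' hn) k (hT' hk)
      have h2 := hTx k (hT' hk) n (hT' hn)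
      have h3 := hTy n hn k hk
      have h4 := hTy k hk n hn
      have e : ((n 0 : ℝ) - k 0) ^ 2 + ((n 1 : ℝ) - k 1) ^ 2
          = ((u * n 0 + w * n 1) - (u * k 0 + w * k 1)) ^ 2
            + ((-w * n 0 + u * n 1) - (-w * k 0 + u * k 1)) ^ 2 := by
        linear_combination (-((n 0 : ℝ) - k 0) ^ 2 - ((n 1 : ℝ) - k 1) ^ 2) * hu
      rw [e]
      nlinarith
    refine card_le_of_windows T' (fun n => (n 0 : ℝ)) (by norm_num) (by norm_num)
      (fun n hn k hk => ?_) fun T₂ hT₂ h0 => ?_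
    · have := hdist n hn k hk
      nlinarith [sq_nonneg ((n 1 : ℝ) - k 1)]
    refine card_le_of_windows T₂ (fun n => (n 1 : ℝ)) (by norm_num) (by norm_num)
      (fun n hn k hk => ?_) fun T₃ hT₃ h1 => ?_
    · have := hdist n (hT₂ hn) k (hT₂ hk)
      nlinarith [sq_nonneg ((n 0 : ℝ) - k 0)]
    have : T₃.card ≤ 1 := by
      refine Finset.card_le_one.2 fun n hn k hk => ?_
      have heq : ∀ i : Fin 2, (n i : ℝ) - k i ≤ 1 / 2 → (k i : ℝ) - n i ≤ 1 / 2 →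
          n i = k i := by
        intro i ha hb
        have ha' : ((n i - k i : ℤ) : ℝ) < 1 := by push_cast; linarith
        have hb' : ((k i - n i : ℤ) : ℝ) < 1 := by push_cast; linarith
        have : n i - k i < 1 := by exact_mod_cast ha'
        have : k i - n i < 1 := by exact_mod_cast hb'
        omega
      ext i
      fin_cases i
      · exact heq 0 (h0 n (hT₃ hn) k (hT₃ hk)) (h0 k (hT₃ hk) n (hT₃ hn))
      · exact heq 1 (h1 n hn k hk) (h1 k hk n hn)
    exact_mod_cast this
  linarith [key]

theorem card_le_of_jb_le (S : Finset (Fin 2 → ℤ)) {R : ℝ} (hR : 1 ≤ R) (hS : ∀ n ∈ S, jb n ≤ R) :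
    (S.card : ℝ) ≤ 144 * R ^ 2 := by
  have hi : ∀ n ∈ S, |(n 0 : ℝ)| ≤ R ∧ |(n 1 : ℝ)| ≤ R := by
    intro n hn
    have h1 := jb_sq n
    have h2 := hS n hn
    have h3 := jb_pos n
    constructor <;> refine abs_le_of_sq_le_sq ?_ (by linarith) <;>
      nlinarith [sq_nonneg (n 0 : ℝ), sq_nonneg (n 1 : ℝ)]
  have := card_le_of_rectangle S (u := 1) (w := 0) (W := 2 * R) (H := 2 * R) (by norm_num)
    (by linarith) (by linarith)
    (fun n hn k hk => by
      have h1 := abs_le.1 (hi n hn).1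
      have h2 := abs_le.1 (hi k hk).1
      linarith)
    (fun n hn k hk => by
      have h1 := abs_le.1 (hi n hn).2
      have h2 := abs_le.1 (hi k hk).2
      linarith)
  nlinarith

theorem sub_sq_le_abs_sq_sub_sq {a b : ℝ} (h : 0 ≤ a * b) : (a - b) ^ 2 ≤ |a ^ 2 - b ^ 2| := by
  have h1 : |a - b| ≤ |a + b| := sq_le_sq.1 (by nlinarith)
  rw [← sq_abs (a - b), show a ^ 2 - b ^ 2 = (a - b) * (a + b) by ring, abs_mul, sq]
  exact mul_le_mul_of_nonneg_left h1 (abs_nonneg _)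

/-- Lattice points of an annulus of thickness `R` on which the phase `⟨n⟩ + σ⟨q - n⟩` lies in a
fixed window. -/
theorem card_le_of_phase_of_annulus {q : Fin 2 → ℤ} (hq : q ≠ 0) {N R W σ t : ℝ} (hN : 1 ≤ N)
    (hW : W = 1 + N / znorm q) (hσ : σ = -1 ∨ σ = 1) (hR : 0 < R) (hRW : R ≤ W)
    (T : Finset (Fin 2 → ℤ)) (hT : ∀ n ∈ T, jb n ≤ 3 * N)
    (hphase : ∀ n ∈ T, |jb n + σ * jb (q - n) - t| ≤ 2)
    (hτ : ∀ n ∈ T, |jb n + σ * jb (q - n)| * R ≤ 6 * (znorm q * W))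
    (hdiff : ∀ n ∈ T, ∀ k ∈ T, jb n - jb k ≤ R) :
    (T.card : ℝ) ≤ 12096 * W * √(N * W) := by
  classical
  have hσ2 : σ ^ 2 = 1 := by rcases hσ with rfl | rfl <;> norm_num
  set Q := znorm q with hQdef
  have hQ : 1 ≤ Q := one_le_znorm hq
  have hQ0 : 0 < Q := by linarith
  have hQ2 := znorm_sq q
  rw [← hQdef] at hQ2
  have hQW : Q * W = Q + N := by rw [hW]; field_simp
  have hW1 : 1 ≤ W := by rw [hW]; linarith [show 0 ≤ N / Q by positivity]
  set u : ℝ := q 0 / Q with hu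
  set w : ℝ := q 1 / Q with hw
  have huw : u ^ 2 + w ^ 2 = 1 := by
    rw [hu, hw]; field_simp; linarith
  have huQ : u * Q = q 0 := by rw [hu]; field_simp
  have hwQ : w * Q = q 1 := by rw [hw]; field_simp
  set X : (Fin 2 → ℤ) → ℝ := fun n => u * n 0 + w * n 1 with hX
  set Y : (Fin 2 → ℤ) → ℝ := fun n => -w * n 0 + u * n 1 with hY
  have hXY : ∀ n, X n ^ 2 + Y n ^ 2 = jb n ^ 2 - 1 := by
    intro n
    simp only [hX, hY]
    rw [jb_sq]
    linear_combination ((n 0 : ℝ) ^ 2 + (n 1 : ℝ) ^ 2) * huw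
  have hXle : ∀ n ∈ T, |X n| ≤ 3 * N := by
    intro n hn
    refine abs_le_of_sq_le_sq ?_ (by linarith)
    nlinarith [hXY n, hT n hn, jb_pos n, sq_nonneg (Y n)]
  have hid : ∀ n, 2 * (Q * X n)
      = Q ^ 2 - (jb n + σ * jb (q - n)) ^ 2 + 2 * (jb n + σ * jb (q - n)) * jb n := by
    intro n
    have h1 := jb_sq n
    have h2 := jb_sq (q - n)
    simp only [Pi.sub_apply, Int.cast_sub] at h2
    have h3 : Q * X n = q 0 * n 0 + q 1 * n 1 := by
      simp only [hX]; linear_combination (n 0 : ℝ) * huQ + (n 1 : ℝ) * hwQ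
    rw [h3]
    linear_combination (-1) * hQ2 - h1 + h2 + jb (q - n) ^ 2 * hσ2
  have hXdiff : ∀ n ∈ T, ∀ k ∈ T, X n - X k ≤ 26 * W := by
    intro n hn k hk
    have h1 := hid n
    have h2 := hid k
    have hτn := abs_le.1 (hphase n hn)
    have hτk := abs_le.1 (hphase k hk)
    have hRk := hτ k hk
    have hsub : |σ * jb (q - n)| ≤ Q + 3 * N := by
      have h := jb_sub_le_znorm_add_jb q n
      have : |σ| = 1 := by rcases hσ with rfl | rfl <;> norm_num
      rw [abs_mul, this, abs_of_pos (jb_pos _)]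
      linarith [hT n hn]
    have hr : |jb n - jb k| ≤ R := abs_le.2 ⟨by linarith [hdiff k hk n hn], hdiff n hn k hk⟩
    generalize hc : jb n + σ * jb (q - n) = c at *
    generalize hd : jb k + σ * jb (q - k) = d at *
    have e : Q * (X n - X k) = (c - d) * (-(σ * jb (q - n)) + (c - d) / 2) + d * (jb n - jb k) := by
      rw [← hc] at h1 ⊢
      linear_combination (1 / 2) * h1 - (1 / 2) * h2
    have hcd : |c - d| ≤ 4 := abs_le.2 ⟨by linarith, by linarith⟩
    have hp1 : (c - d) * (-(σ * jb (q - n)) + (c - d) / 2) ≤ 4 * (Q + 3 * N + 2) := by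
      refine (le_abs_self _).trans ?_
      rw [abs_mul]
      refine mul_le_mul hcd ?_ (abs_nonneg _) (by norm_num)
      refine (abs_add_le _ _).trans ?_
      rw [abs_neg, abs_div, abs_two]
      linarith
    have hp2 : d * (jb n - jb k) ≤ 6 * (Q * W) := by
      refine (le_abs_self _).trans ?_
      rw [abs_mul]
      exact (mul_le_mul_of_nonneg_left hr (abs_nonneg _)).trans hRk
    have : Q * (X n - X k) ≤ Q * (26 * W) := by
      rw [e]; linarith
    exact le_of_mul_le_mul_left this hQ0
  have hNW : 1 ≤ N * W := by nlinarith
  have hsq1 : 1 ≤ √(N * W) := Real.one_le_sqrt.2 hNW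
  have hsq2 : √(N * W) ^ 2 = N * W := Real.sq_sqrt (by linarith)
  have hYsq : ∀ n ∈ T, ∀ k ∈ T, Y n ^ 2 - Y k ^ 2 ≤ 162 * (N * W) := by
    intro n hn k hk
    have h1 : jb n ^ 2 - jb k ^ 2 ≤ 6 * (N * W) := by
      have hs : 0 ≤ jb n + jb k := add_nonneg (jb_pos n).le (jb_pos k).le
      have := mul_le_mul_of_nonneg_right ((hdiff n hn k hk).trans hRW) hs
      nlinarith [hT n hn, hT k hk]
    have h2 : X k ^ 2 - X n ^ 2 ≤ 156 * (N * W) := by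
      have ha : |X k - X n| ≤ 26 * W :=
        abs_le.2 ⟨by linarith [hXdiff n hn k hk], hXdiff k hk n hn⟩
      have hb : |X k + X n| ≤ 6 * N :=
        (abs_add_le _ _).trans (by linarith [hXle n hn, hXle k hk])
      calc X k ^ 2 - X n ^ 2 = (X k - X n) * (X k + X n) := by ring
        _ ≤ |(X k - X n) * (X k + X n)| := le_abs_self _
        _ = |X k - X n| * |X k + X n| := abs_mul _ _
        _ ≤ (26 * W) * (6 * N) := mul_le_mul ha hb (abs_nonneg _) (by linarith)
        _ = 156 * (N * W) := by ring
    linarith [hXY n, hXY k]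
  have hhalf : ∀ T' ⊆ T, (∀ n ∈ T', ∀ k ∈ T', 0 ≤ Y n * Y k) →
      (T'.card : ℝ) ≤ 16 * (26 * W + 1) * (13 * √(N * W) + 1) := by
    intro T' hT' hs
    refine card_le_of_rectangle T' huw (by linarith) (by linarith)
      (fun n hn k hk => hXdiff n (hT' hn) k (hT' hk)) fun n hn k hk => ?_
    change Y n - Y k ≤ _
    refine (abs_le_of_sq_le_sq' ?_ (by linarith)).2
    have h1 := hYsq n (hT' hn) k (hT' hk)
    have h2 := hYsq k (hT' hk) n (hT' hn)
    have h3 := hs n hn k hk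
    rw [mul_pow, hsq2]
    exact (sub_sq_le_abs_sq_sub_sq h3).trans (abs_le.2 ⟨by linarith, by linarith⟩)
  have hpos := hhalf (T.filter fun n => 0 ≤ Y n) (Finset.filter_subset _ _) fun n hn k hk =>
    mul_nonneg (Finset.mem_filter.1 hn).2 (Finset.mem_filter.1 hk).2
  have hneg := hhalf (T.filter fun n => ¬ 0 ≤ Y n) (Finset.filter_subset _ _) fun n hn k hk =>
    mul_nonneg_of_nonpos_of_nonpos (not_le.1 (Finset.mem_filter.1 hn).2).le
      (not_le.1 (Finset.mem_filter.1 hk).2).le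
  have hcard : (T.card : ℝ) = ((T.filter fun n => 0 ≤ Y n).card : ℝ)
      + ((T.filter fun n => ¬ 0 ≤ Y n).card : ℝ) := by
    exact_mod_cast (Finset.card_filter_add_card_filter_not (s := T) (fun n => 0 ≤ Y n)).symm
  have hb : (26 * W + 1) * (13 * √(N * W) + 1) ≤ (27 * W) * (14 * √(N * W)) :=
    mul_le_mul (by linarith) (by linarith) (by linarith) (by linarith)
  nlinarith

theorem card_le_of_phase_sqrt {q : Fin 2 → ℤ} (hq : q ≠ 0) {N σ t : ℝ} (hN : 1 ≤ N)
    (hσ : σ = -1 ∨ σ = 1) (S : Finset (Fin 2 → ℤ)) (hS : ∀ n ∈ S, jb n ≤ 3 * N)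
    (hphase : ∀ n ∈ S, |jb n + σ * jb (q - n) - t| ≤ 2) :
    (S.card : ℝ) ≤ 96768 * N * √(N * (1 + N / znorm q)) := by
  obtain ⟨W, hW⟩ : ∃ W, W = 1 + N / znorm q := ⟨_, rfl⟩
  rw [← hW]
  have hQ : 1 ≤ znorm q := one_le_znorm hq
  have hQ0 : 0 < znorm q := by linarith
  have hQW : znorm q * W = znorm q + N := by rw [hW]; field_simp
  have hW1 : 1 ≤ W := by rw [hW]; linarith [show 0 ≤ N / znorm q by positivity]
  have hW0 : 0 < W := by linarith
  have hWN : W ≤ 2 * N := by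
    have : N / znorm q ≤ N := div_le_self (by linarith) hQ
    rw [hW]; linarith
  have hd : ∀ n, |jb n - jb (q - n)| ≤ znorm q := fun n =>
    abs_le.2 ⟨by linarith [jb_sub_le_znorm_add_jb q n], by linarith [jb_le_znorm_add_jb_sub q n]⟩
  have hB : 0 ≤ 12096 * W * √(N * W) := by positivity
  have hfin : ∀ M : ℝ, M * W ≤ 8 * N → M * (12096 * W * √(N * W)) ≤ 96768 * N * √(N * W) := by
    intro M hM
    nlinarith [mul_le_mul_of_nonneg_right hM (Real.sqrt_nonneg (N * W))]
  rcases hσ with rfl | rfl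
  · have h := card_le_of_windows S jb (D := 3 * N) hW0 (by linarith)
      (fun n hn k hk => by linarith [hS n hn, jb_pos k])
      (fun T hT hdiff => card_le_of_phase_of_annulus hq (σ := -1) (t := t) hN hW (Or.inl rfl) hW0
        le_rfl T (fun n hn => hS n (hT hn)) (fun n hn => hphase n (hT hn)) (fun n _ => ?_) hdiff)
    · refine h.trans (hfin _ ?_)
      have : (3 * N / W + 1) * W = 3 * N + W := by field_simp
      linarith
    · have := hd n
      rw [show jb n + -1 * jb (q - n) = jb n - jb (q - n) by ring]
      nlinarith [mul_le_mul_of_nonneg_right this hW0.le]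
  · have hτ : ∀ n ∈ S, |jb n + 1 * jb (q - n)| * 1 ≤ 6 * (znorm q * W) := by
      intro n hn
      rw [abs_of_nonneg (by linarith [jb_pos n, jb_pos (q - n)])]
      linarith [jb_sub_le_znorm_add_jb q n, hS n hn]
    have hann : ∀ T ⊆ S, (∀ n ∈ T, ∀ k ∈ T, jb n - jb k ≤ 1) →
        (T.card : ℝ) ≤ 12096 * W * √(N * W) := fun T hT hdiff =>
      card_le_of_phase_of_annulus hq (σ := 1) (t := t) hN hW (Or.inr rfl) one_pos
        hW1 T (fun n hn => hS n (hT hn)) (fun n hn => hphase n (hT hn))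
        (fun n hn => hτ n (hT hn)) hdiff
    rcases le_total (znorm q) N with hle | hle
    · refine (card_le_of_windows S jb (D := 3 * znorm q) one_pos (by linarith)
        (fun n hn k hk => ?_) hann).trans (hfin _ ?_)
      · linarith [(abs_le.1 (hphase n hn)).2, (abs_le.1 (hphase k hk)).1, (abs_le.1 (hd n)).2,
          (abs_le.1 (hd k)).1]
      · nlinarith
    · refine (card_le_of_windows S jb (D := 3 * N) one_pos (by linarith)
        (fun n hn k hk => by linarith [hS n hn, jb_pos k]) hann).trans (hfin _ ?_)
      have : N / znorm q ≤ 1 := (div_le_one hQ0).2 hle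
      nlinarith

/-- Counting lemma: the lattice points in a ball of radius `N` on which a two-wave phase lies in a
fixed window. -/
theorem card_le_of_phase (q : Fin 2 → ℤ) {N σ σ' t : ℝ} (hN : 1 ≤ N) (hσ : σ = -1 ∨ σ = 1)
    (hσ' : σ' = -1 ∨ σ' = 1) (S : Finset (Fin 2 → ℤ))
    (hS : ∀ n ∈ S, jb n ≤ 3 * N ∧ |σ * jb n + σ' * jb (q - n) - t| ≤ 2) :
    (S.card : ℝ) ≤ 193536 * N ^ 2 * (N ^ (-(1 / 2) : ℝ) + jb q ^ (-(1 / 2) : ℝ)) := by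
  have hN0 : 0 < N := by linarith
  have hnr : ∀ x : ℝ, 0 < x → x ^ (-(1 / 2) : ℝ) = (√x)⁻¹ := fun x hx => by
    rw [Real.rpow_neg hx.le, ← Real.sqrt_eq_rpow]
  by_cases hq : q = 0
  · have h1 := card_le_of_jb_le S (R := 3 * N) (by linarith) (fun n hn => (hS n hn).1)
    have h2 : jb q = 1 := by simp [hq, jb]
    have h3 : 0 ≤ N ^ 2 * N ^ (-(1 / 2) : ℝ) := by positivity
    rw [h2, Real.one_rpow]
    nlinarith [sq_nonneg N]
  · have hQ : 1 ≤ znorm q := one_le_znorm hq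
    have hQ0 : 0 < znorm q := by linarith
    have hcard : (S.card : ℝ) ≤ 96768 * N * √(N * (1 + N / znorm q)) := by
      rcases hσ with rfl | rfl
      · refine card_le_of_phase_sqrt hq (σ := -σ') (t := -t) hN ?_ S (fun n hn => (hS n hn).1)
          fun n hn => ?_
        · rcases hσ' with rfl | rfl <;> norm_num
        · rw [← abs_neg]
          convert (hS n hn).2 using 2
          ring
      · exact card_le_of_phase_sqrt hq (t := t) hN hσ' S (fun n hn => (hS n hn).1)
          fun n hn => by simpa using (hS n hn).2
    refine hcard.trans ?_
    have hjq : jb q ≤ 4 * znorm q := by linarith [jb_le_znorm_add_one q]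
    have hs1 : √(N * (1 + N / znorm q)) ≤ √N + √(N ^ 2 / znorm q) := by
      refine Real.sqrt_le_iff.2 ⟨by positivity, ?_⟩
      rw [add_sq, Real.sq_sqrt hN0.le, Real.sq_sqrt (by positivity)]
      have : N * (1 + N / znorm q) = N + N ^ 2 / znorm q := by ring
      have h2 : 0 ≤ 2 * √N * √(N ^ 2 / znorm q) := by positivity
      linarith
    have hs2 : √(N ^ 2 / znorm q) ≤ 2 * N * (√(jb q))⁻¹ := by
      rw [Real.sqrt_div (sq_nonneg N), Real.sqrt_sq hN0.le, ← div_eq_mul_inv,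
        div_le_div_iff₀ (Real.sqrt_pos.2 hQ0) (Real.sqrt_pos.2 (jb_pos q))]
      have h4 : √(4 : ℝ) = 2 := by
        rw [show (4 : ℝ) = 2 ^ 2 by norm_num]; exact Real.sqrt_sq (by norm_num)
      have : √(jb q) ≤ 2 * √(znorm q) := by
        rw [← h4, ← Real.sqrt_mul (by norm_num)]
        exact Real.sqrt_le_sqrt hjq
      nlinarith
    have hs3 : √N = N * (√N)⁻¹ := by
      have := Real.sqrt_pos.2 hN0
      field_simp
      exact Real.sq_sqrt hN0.le
    rw [hnr N hN0, hnr _ (jb_pos q)]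
    have h0 : 0 ≤ N * (√N)⁻¹ := by positivity
    have h5 : √(N * (1 + N / znorm q)) ≤ 2 * N * ((√N)⁻¹ + (√(jb q))⁻¹) := by linarith
    nlinarith

open scoped ENNReal

/-- An indicator-weighted sum is bounded by the weight times a uniform bound on the cardinality. -/
theorem ENNReal.tsum_ite_le {ι : Type*} (P : ι → Prop) [DecidablePred P] {K : ℝ} (c : ℝ≥0∞)
    (h : ∀ S : Finset ι, (∀ i ∈ S, P i) → (S.card : ℝ) ≤ K) :
    ∑' i, (if P i then c else 0) ≤ ENNReal.ofReal K * c := by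
  rw [ENNReal.tsum_eq_iSup_sum]
  refine iSup_le fun S => ?_
  rw [← Finset.sum_filter, Finset.sum_const, nsmul_eq_mul]
  gcongr
  rw [← ENNReal.ofReal_natCast]
  exact ENNReal.ofReal_le_ofReal (h _ fun i hi => (Finset.mem_filter.1 hi).2)

theorem summable_jb_rpow {δ : ℝ} (hδ : 0 < δ) :
    Summable fun x : Fin 2 → ℤ => jb x ^ (-(2 + δ)) := by
  have h1 := EisensteinSeries.summable_one_div_norm_rpow (k := 2 + δ) (by linarith)
  have h2 : Summable fun x : Fin 2 → ℤ => if x = 0 then (1 : ℝ) else 0 :=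
    summable_of_hasFiniteSupport ((Set.finite_singleton (0 : Fin 2 → ℤ)).subset fun x hx => by
      by_contra hne
      exact hx (if_neg hne))
  refine Summable.of_nonneg_of_le (fun x => Real.rpow_nonneg (jb_pos x).le _) (fun x => ?_)
    (h1.add h2)
  by_cases hx : x = 0
  · rw [if_pos hx]
    have : jb x ^ (-(2 + δ)) ≤ 1 := Real.rpow_le_one_of_one_le_of_nonpos (one_le_jb x) (by linarith)
    have : 0 ≤ ‖x‖ ^ (-(2 + δ)) := by positivity
    linarith
  · rw [if_neg hx, add_zero]
    refine Real.rpow_le_rpow_of_nonpos (norm_pos_iff.2 hx) ?_ (by linarith)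
    refine (pi_norm_le_iff_of_nonneg (jb_pos x).le).2 fun i => ?_
    rw [Int.norm_eq_abs]
    refine abs_le_of_sq_le_sq ?_ (jb_pos x).le
    rw [jb_sq]
    fin_cases i <;> simp <;> nlinarith [sq_nonneg (x 0 : ℝ), sq_nonneg (x 1 : ℝ)]

open Classical in
/-- Power-weighted sums over balls in `ℤ²`, with an arbitrarily small loss. -/
theorem exists_tsum_jb_rpow_le {δ : ℝ} (hδ : 0 < δ) : ∃ C : ℝ, 0 < C ∧
    ∀ R a : ℝ, 1 ≤ R → 0 ≤ a → a ≤ 2 → ∀ p : Fin 2 → ℤ,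
      ∑' q : Fin 2 → ℤ, (if jb q ≤ 9 * R then ENNReal.ofReal (jb (p + q) ^ (-a)) else 0) ≤
        ENNReal.ofReal (C * R ^ (2 + δ - a)) := by
  have hsum := summable_jb_rpow hδ
  set A := ∑' x : Fin 2 → ℤ, jb x ^ (-(2 + δ)) with hA
  have hA0 : 0 ≤ A := tsum_nonneg fun x => Real.rpow_nonneg (jb_pos x).le _
  refine ⟨11664 + A, by linarith, fun R a hR ha ha2 p => ?_⟩
  have hR0 : 0 < R := by linarith
  have hpt : ∀ x : Fin 2 → ℤ, jb x ^ (-a) ≤ R ^ (-a) + R ^ (2 + δ - a) * jb x ^ (-(2 + δ)) := by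
    intro x
    have hx := jb_pos x
    rcases le_total (jb x) R with h | h
    · have h1 : jb x ^ (-a) = jb x ^ (2 + δ - a) * jb x ^ (-(2 + δ)) := by
        rw [← Real.rpow_add hx]; congr 1; ring
      have h2 : jb x ^ (2 + δ - a) ≤ R ^ (2 + δ - a) :=
        Real.rpow_le_rpow hx.le h (by linarith)
      have h3 : 0 ≤ R ^ (-a) := by positivity
      rw [h1]
      nlinarith [mul_le_mul_of_nonneg_right h2 (Real.rpow_nonneg hx.le (-(2 + δ)))]
    · have h2 : jb x ^ (-a) ≤ R ^ (-a) := Real.rpow_le_rpow_of_nonpos hR0 h (by linarith)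
      have h3 : 0 ≤ R ^ (2 + δ - a) * jb x ^ (-(2 + δ)) := by positivity
      linarith
  calc _ ≤ ∑' q : Fin 2 → ℤ, ((if jb q ≤ 9 * R then ENNReal.ofReal (R ^ (-a)) else 0) +
        ENNReal.ofReal (R ^ (2 + δ - a)) * ENNReal.ofReal (jb (p + q) ^ (-(2 + δ)))) := by
        refine ENNReal.tsum_le_tsum fun q => ?_
        split_ifs
        · rw [← ENNReal.ofReal_mul (by positivity),
            ← ENNReal.ofReal_add (by positivity) (mul_nonneg (by positivity)
              (Real.rpow_nonneg (jb_pos _).le _))]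
          exact ENNReal.ofReal_le_ofReal (hpt _)
        · exact zero_le
    _ ≤ ENNReal.ofReal (11664 * R ^ 2) * ENNReal.ofReal (R ^ (-a)) +
        ENNReal.ofReal (R ^ (2 + δ - a)) * ENNReal.ofReal A := by
        rw [ENNReal.tsum_add, ENNReal.tsum_mul_left]
        gcongr
        · refine ENNReal.tsum_ite_le _ _ fun S hS => ?_
          refine (card_le_of_jb_le S (R := 9 * R) (by linarith) hS).trans (le_of_eq (by ring))
        · rw [← Equiv.tsum_eq (Equiv.addLeft (-p)), hA,
            ENNReal.ofReal_tsum_of_nonneg (fun x => Real.rpow_nonneg (jb_pos x).le _) hsum]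
          simp
    _ ≤ ENNReal.ofReal ((11664 + A) * R ^ (2 + δ - a)) := by
        rw [← ENNReal.ofReal_mul (by positivity), ← ENNReal.ofReal_mul (by positivity),
          ← ENNReal.ofReal_add (by positivity) (by positivity)]
        refine ENNReal.ofReal_le_ofReal ?_
        have h1 : R ^ 2 * R ^ (-a) ≤ R ^ (2 + δ - a) := by
          rw [← Real.rpow_natCast, ← Real.rpow_add hR0]
          exact Real.rpow_le_rpow_of_exponent_le hR (by push_cast; linarith)
        linarith

open Classical in
/-- Summation over two resonant frequencies reduces to a weighted sum over their sum. -/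
theorem tsum_pair_le {N M σ σ' : ℝ} (hN : 1 ≤ N) (hσ : σ = -1 ∨ σ = 1) (hσ' : σ' = -1 ∨ σ' = 1)
    (c : (Fin 2 → ℤ) → ℝ) (w : (Fin 2 → ℤ) → ℝ≥0∞) :
    ∑' x : Fin 2 → ℤ, ∑' y : Fin 2 → ℤ,
      (if jb x ≤ 3 * N ∧ jb y ≤ 3 * M ∧ |σ * jb x + σ' * jb y - c (x + y)| ≤ 2
        then w (x + y) else 0) ≤
    ∑' q : Fin 2 → ℤ, (if jb q ≤ 3 * (N + M) then
      ENNReal.ofReal (193536 * N ^ 2 * (N ^ (-(1 / 2) : ℝ) + jb q ^ (-(1 / 2) : ℝ))) * w q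
        else 0) := by
  have h1 : ∀ x : Fin 2 → ℤ, ∑' y : Fin 2 → ℤ,
      (if jb x ≤ 3 * N ∧ jb y ≤ 3 * M ∧ |σ * jb x + σ' * jb y - c (x + y)| ≤ 2
        then w (x + y) else 0) = ∑' q : Fin 2 → ℤ,
      (if jb x ≤ 3 * N ∧ jb (q - x) ≤ 3 * M ∧ |σ * jb x + σ' * jb (q - x) - c q| ≤ 2
        then w q else 0) := by
    intro x
    rw [← Equiv.tsum_eq (Equiv.subRight x)]
    simp
  simp_rw [h1]
  rw [ENNReal.tsum_comm]
  refine ENNReal.tsum_le_tsum fun q => ?_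
  split_ifs with hq
  · exact ENNReal.tsum_ite_le _ _ fun S hS =>
      card_le_of_phase q hN hσ hσ' S (t := c q) fun n hn => ⟨(hS n hn).1, (hS n hn).2.2⟩
  · refine le_of_eq (ENNReal.tsum_eq_zero.2 fun x => if_neg ?_)
    rintro ⟨ha, hb, -⟩
    have := jb_add_le x (q - x)
    rw [add_sub_cancel] at this
    exact hq (by linarith)

theorem rpow_mul_rpow_le {x M e f g : ℝ} (hx : 1 ≤ x) (hxM : x ≤ M) (h : max e 0 + f ≤ g) :
    x ^ e * M ^ f ≤ M ^ g := by
  have hM : 1 ≤ M := hx.trans hxM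
  have hM0 : 0 < M := by linarith
  calc x ^ e * M ^ f ≤ M ^ (max e 0) * M ^ f := by
        gcongr
        exact (Real.rpow_le_rpow_of_exponent_le hx (le_max_left _ _)).trans
          (Real.rpow_le_rpow (by linarith) hxM (le_max_right _ _))
    _ = M ^ (max e 0 + f) := (Real.rpow_add hM0 _ _).symm
    _ ≤ M ^ g := Real.rpow_le_rpow_of_exponent_le hM h

theorem rpow_mul_rpow_le_add {x y a b : ℝ} (hx : 0 < x) (hy : 0 < y) (ha : 0 ≤ a) (hb : 0 ≤ b) :
    x ^ (-a) * y ^ (-b) ≤ x ^ (-(a + b)) + y ^ (-(a + b)) := by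
  have h : ∀ z : ℝ, 0 < z → z ^ (-(a + b)) = z ^ (-a) * z ^ (-b) := fun z hz => by
    rw [← Real.rpow_add hz]; congr 1; ring
  have hxa := Real.rpow_pos_of_pos hx (-a)
  have hyb := Real.rpow_pos_of_pos hy (-b)
  have hx' := Real.rpow_pos_of_pos hx (-(a + b))
  have hy' := Real.rpow_pos_of_pos hy (-(a + b))
  rcases le_total x y with hle | hle
  · have : y ^ (-b) ≤ x ^ (-b) := Real.rpow_le_rpow_of_nonpos hx hle (by linarith)
    have := mul_le_mul_of_nonneg_left this hxa.le
    rw [← h x hx] at this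
    linarith
  · have : x ^ (-a) ≤ y ^ (-a) := Real.rpow_le_rpow_of_nonpos hy hle (by linarith)
    have := mul_le_mul_of_nonneg_right this hyb.le
    rw [← h y hy] at this
    linarith

theorem sq_mul_rpow {N : ℝ} (hN : 0 < N) (e : ℝ) : N ^ 2 * N ^ e = N ^ (2 + e) := by
  rw [← Real.rpow_natCast, ← Real.rpow_add hN]
  norm_num

open Classical in
theorem exists_pair_bound_of_le {α a : ℝ} (ha0 : 0 ≤ a) (ha : a ≤ 3 / 2)
    (hαa : 2 * α + max (2 * α - 1 / 2) 0 < a) :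
    ∃ ε C : ℝ, 0 < ε ∧ 0 < C ∧ ∀ N M : ℝ, 1 ≤ N → N ≤ M → ∀ σ σ' : ℝ, (σ = -1 ∨ σ = 1) →
      (σ' = -1 ∨ σ' = 1) → ∀ (p : Fin 2 → ℤ) (c : (Fin 2 → ℤ) → ℝ),
      (∑' x : Fin 2 → ℤ, ∑' y : Fin 2 → ℤ,
        (if jb x ≤ 3 * N ∧ jb y ≤ 3 * M ∧ |σ * jb x + σ' * jb y - c (x + y)| ≤ 2
          then ENNReal.ofReal (jb (p + (x + y)) ^ (-a)) else 0)) *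
        ENNReal.ofReal (N ^ (-2 + 2 * α) * M ^ (-2 + 2 * α)) ≤ ENNReal.ofReal (C * M ^ (-ε)) := by
  set μ := max (2 * α - 1 / 2) 0 with hμ
  have hμ1 : 2 * α - 1 / 2 ≤ μ := le_max_left _ _
  have hμ0 : 0 ≤ μ := le_max_right _ _
  obtain ⟨δ, hδ⟩ : ∃ δ, δ = (a - 2 * α - μ) / 2 := ⟨_, rfl⟩
  have hδ0 : 0 < δ := by rw [hδ]; linarith
  obtain ⟨C, hC, hsum⟩ := exists_tsum_jb_rpow_le hδ0
  refine ⟨δ, 580608 * C, hδ0, by positivity, fun N M hN hNM σ σ' hσ hσ' p c => ?_⟩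
  have hM : 1 ≤ M := hN.trans hNM
  have hN0 : 0 < N := by linarith
  have hM0 : 0 < M := by linarith
  obtain ⟨A₂, hA₂⟩ : ∃ A : ℝ, A = 193536 * N ^ 2 := ⟨_, rfl⟩
  obtain ⟨A₁, hA₁⟩ : ∃ A : ℝ, A = A₂ * N ^ (-(1 / 2) : ℝ) := ⟨_, rfl⟩
  have hA₂0 : 0 ≤ A₂ := by rw [hA₂]; positivity
  have hA₁0 : 0 ≤ A₁ := by rw [hA₁]; positivity
  have hbound : ∑' x : Fin 2 → ℤ, ∑' y : Fin 2 → ℤ,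
        (if jb x ≤ 3 * N ∧ jb y ≤ 3 * M ∧ |σ * jb x + σ' * jb y - c (x + y)| ≤ 2
          then ENNReal.ofReal (jb (p + (x + y)) ^ (-a)) else 0) ≤
      ENNReal.ofReal (A₁ * (C * M ^ (2 + δ - a)) + A₂ * (C * M ^ (2 + δ - (a + 1 / 2))
        + C * M ^ (2 + δ - (a + 1 / 2)))) := by
    refine (tsum_pair_le hN hσ hσ' c fun q => ENNReal.ofReal (jb (p + q) ^ (-a))).trans ?_
    calc _ ≤ ∑' q : Fin 2 → ℤ, (ENNReal.ofReal A₁ *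
          (if jb q ≤ 9 * M then ENNReal.ofReal (jb (p + q) ^ (-a)) else 0) + ENNReal.ofReal A₂ *
          ((if jb q ≤ 9 * M then ENNReal.ofReal (jb (p + q) ^ (-(a + 1 / 2))) else 0) +
          (if jb q ≤ 9 * M then ENNReal.ofReal (jb (0 + q) ^ (-(a + 1 / 2))) else 0))) := by
          refine ENNReal.tsum_le_tsum fun q => ?_
          split_ifs with h1 h2
          · have hj := Real.rpow_pos_of_pos (jb_pos (p + q))
            have hj' := Real.rpow_pos_of_pos (jb_pos q)
            rw [zero_add, ← ENNReal.ofReal_add (hj _).le (hj' _).le,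
              ← ENNReal.ofReal_mul hA₁0, ← ENNReal.ofReal_mul hA₂0,
              ← ENNReal.ofReal_add (mul_nonneg hA₁0 (hj _).le)
                (mul_nonneg hA₂0 (add_pos (hj _) (hj' _)).le),
              ← ENNReal.ofReal_mul (mul_nonneg (by positivity)
                (add_nonneg (by positivity) (hj' _).le))]
            refine ENNReal.ofReal_le_ofReal ?_
            have := rpow_mul_rpow_le_add (jb_pos (p + q)) (jb_pos q) ha0
              (by norm_num : (0 : ℝ) ≤ 1 / 2)
            have := mul_le_mul_of_nonneg_left this hA₂0
            rw [← hA₂, hA₁]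
            linarith
          · exact absurd (by linarith) h2
          all_goals exact zero_le
      _ ≤ _ := by
          have hR : 0 ≤ C * M ^ (2 + δ - (a + 1 / 2)) := by positivity
          rw [ENNReal.tsum_add, ENNReal.tsum_mul_left, ENNReal.tsum_mul_left, ENNReal.tsum_add,
            ENNReal.ofReal_add (by positivity) (by positivity), ENNReal.ofReal_mul hA₁0,
            ENNReal.ofReal_mul hA₂0, ENNReal.ofReal_add hR hR]
          gcongr
          · exact hsum M a hM ha0 (by linarith) p
          · exact hsum M (a + 1 / 2) hM (by linarith) (by linarith) p
          · exact hsum M (a + 1 / 2) hM (by linarith) (by linarith) 0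
  refine (mul_le_mul_left hbound _).trans ?_
  rw [← ENNReal.ofReal_mul (by positivity)]
  refine ENNReal.ofReal_le_ofReal ?_
  have e1 : N ^ 2 * N ^ (-(1 / 2) : ℝ) * N ^ (-2 + 2 * α) = N ^ (2 * α - 1 / 2) := by
    rw [sq_mul_rpow hN0, ← Real.rpow_add hN0]; congr 1; ring
  have e2 : N ^ 2 * N ^ (-2 + 2 * α) = N ^ (2 * α) := by
    rw [sq_mul_rpow hN0]; congr 1; ring
  have e3 : M ^ (2 + δ - a) * M ^ (-2 + 2 * α) = M ^ (2 * α + δ - a) := by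
    rw [← Real.rpow_add hM0]; congr 1; ring
  have e4 : M ^ (2 + δ - (a + 1 / 2)) * M ^ (-2 + 2 * α) = M ^ (2 * α - 1 / 2 + δ - a) := by
    rw [← Real.rpow_add hM0]; congr 1; ring
  have b1 : N ^ (2 * α - 1 / 2) * M ^ (2 * α + δ - a) ≤ M ^ (-δ) :=
    rpow_mul_rpow_le hN hNM (by rw [← hμ]; linarith)
  have b2 : N ^ (2 * α) * M ^ (2 * α - 1 / 2 + δ - a) ≤ M ^ (-δ) := by
    refine rpow_mul_rpow_le hN hNM ?_
    rcases max_cases (2 * α) 0 with ⟨h, -⟩ | ⟨h, h'⟩ <;> rw [h] <;> linarith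
  calc _ = 193536 * C * ((N ^ 2 * N ^ (-(1 / 2) : ℝ) * N ^ (-2 + 2 * α)) *
        (M ^ (2 + δ - a) * M ^ (-2 + 2 * α)) + 2 * ((N ^ 2 * N ^ (-2 + 2 * α)) *
          (M ^ (2 + δ - (a + 1 / 2)) * M ^ (-2 + 2 * α)))) := by
        rw [hA₁, hA₂]; ring
    _ ≤ 193536 * C * (M ^ (-δ) + 2 * M ^ (-δ)) := by
        rw [e1, e2, e3, e4]
        gcongr
    _ = 580608 * C * M ^ (-δ) := by ring

open Classical in
/-- The sum over `n₁, n₅`, uniformly in the frequency `p = n₂₃₄`. -/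
theorem exists_pair_bound {α a : ℝ} (ha0 : 0 ≤ a) (ha : a ≤ 3 / 2)
    (hαa : 2 * α + max (2 * α - 1 / 2) 0 < a) :
    ∃ ε C : ℝ, 0 < ε ∧ 0 < C ∧ ∀ N M : ℝ, 1 ≤ N → 1 ≤ M → ∀ σ σ' : ℝ, (σ = -1 ∨ σ = 1) →
      (σ' = -1 ∨ σ' = 1) → ∀ (p : Fin 2 → ℤ) (c : (Fin 2 → ℤ) → ℝ),
      (∑' x : Fin 2 → ℤ, ∑' y : Fin 2 → ℤ,
        (if jb x ≤ 3 * N ∧ jb y ≤ 3 * M ∧ |σ * jb x + σ' * jb y - c (x + y)| ≤ 2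
          then ENNReal.ofReal (jb (p + (x + y)) ^ (-a)) else 0)) *
        ENNReal.ofReal (N ^ (-2 + 2 * α) * M ^ (-2 + 2 * α)) ≤
      ENNReal.ofReal (C * (max N M) ^ (-ε)) := by
  obtain ⟨ε, C, hε, hC, H⟩ := exists_pair_bound_of_le ha0 ha hαa
  refine ⟨ε, C, hε, hC, fun N M hN hM σ σ' hσ hσ' p c => ?_⟩
  rcases le_total N M with h | h
  · rw [max_eq_right h]
    exact H N M hN h σ σ' hσ hσ' p c
  · rw [max_eq_left h, ENNReal.tsum_comm, mul_comm (N ^ _)]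
    refine le_trans (le_of_eq ?_) (H M N hM h σ' σ hσ' hσ p c)
    congr 1
    refine tsum_congr fun y => tsum_congr fun x => ?_
    rw [add_comm y x, add_comm (σ' * _)]
    exact if_congr (by tauto) rfl rfl

open Classical in
theorem exists_triple_bound_of_le {α : ℝ} (hα : 0 < α)
    (hα' : 4 * α + max (2 * α - 1 / 2) 0 < 2) :
    ∃ ε C : ℝ, 0 < ε ∧ 0 < C ∧ ∀ B N M : ℝ, 1 ≤ B → 1 ≤ N → B ≤ M → N ≤ M →
      ∀ τ σ σ' : ℝ, (σ = -1 ∨ σ = 1) → (σ' = -1 ∨ σ' = 1) → ∀ c : (Fin 2 → ℤ) → ℝ,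
      (∑' b : Fin 2 → ℤ, ∑' x : Fin 2 → ℤ, ∑' y : Fin 2 → ℤ,
        (if jb b ≤ 3 * B ∧ jb x ≤ 3 * N ∧ jb y ≤ 3 * M ∧
            |τ * jb b + σ * jb x + σ' * jb y - c (b + (x + y))| ≤ 2
          then ENNReal.ofReal (jb (b + (x + y)) ^ (-2 : ℝ)) else 0)) *
        ENNReal.ofReal (B ^ (-2 + 2 * α) * N ^ (-2 + 2 * α) * M ^ (-2 + 2 * α)) ≤
      ENNReal.ofReal (C * M ^ (-ε)) := by
  set μ := max (2 * α - 1 / 2) 0 with hμ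
  have hμ1 : 2 * α - 1 / 2 ≤ μ := le_max_left _ _
  have hμ0 : 0 ≤ μ := le_max_right _ _
  obtain ⟨δ, hδ⟩ : ∃ δ, δ = (2 - 4 * α - μ) / 4 := ⟨_, rfl⟩
  have hδ0 : 0 < δ := by rw [hδ]; linarith
  obtain ⟨C, hC, hsum⟩ := exists_tsum_jb_rpow_le hδ0
  refine ⟨δ, 387072 * (C * C), hδ0, by positivity,
    fun B N M hB hN hBM hNM τ σ σ' hσ hσ' c => ?_⟩
  have hM : 1 ≤ M := hN.trans hNM
  have hB0 : 0 < B := by linarith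
  have hN0 : 0 < N := by linarith
  have hM0 : 0 < M := by linarith
  set K : (Fin 2 → ℤ) → ℝ := fun q =>
    193536 * N ^ 2 * (N ^ (-(1 / 2) : ℝ) + jb q ^ (-(1 / 2) : ℝ)) with hK
  obtain ⟨A₂, hA₂⟩ : ∃ A : ℝ, A = 193536 * N ^ 2 := ⟨_, rfl⟩
  obtain ⟨A₁, hA₁⟩ : ∃ A : ℝ, A = A₂ * N ^ (-(1 / 2) : ℝ) := ⟨_, rfl⟩
  have hA₂0 : 0 ≤ A₂ := by rw [hA₂]; positivity
  have hA₁0 : 0 ≤ A₁ := by rw [hA₁]; positivity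
  set w : (Fin 2 → ℤ) → ℝ≥0∞ := fun p => ENNReal.ofReal (jb p ^ (-2 : ℝ)) with hw
  set E : ℝ := A₁ * (C * B ^ (2 + δ - 0)) + A₂ * (C * B ^ (2 + δ - 1 / 2)) with hE
  have hE0 : 0 ≤ E := by positivity
  have hinner : ∀ p : Fin 2 → ℤ, ∑' b : Fin 2 → ℤ,
      (if jb b ≤ 9 * B then ENNReal.ofReal (K (p - b)) else 0) ≤ ENNReal.ofReal E := by
    intro p
    calc _ = ∑' b : Fin 2 → ℤ, (ENNReal.ofReal A₁ *
          (if jb b ≤ 9 * B then ENNReal.ofReal (jb (0 + b) ^ (-0 : ℝ)) else 0) +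
          ENNReal.ofReal A₂ *
          (if jb b ≤ 9 * B then ENNReal.ofReal (jb (-p + b) ^ (-(1 / 2) : ℝ)) else 0)) := by
          refine tsum_congr fun b => ?_
          split_ifs
          · have hj := Real.rpow_pos_of_pos (jb_pos (p - b)) (-(1 / 2))
            rw [neg_zero, Real.rpow_zero, ENNReal.ofReal_one, mul_one, neg_add_eq_sub,
              jb_sub_comm b p, ← ENNReal.ofReal_mul hA₂0,
              ← ENNReal.ofReal_add hA₁0 (mul_nonneg hA₂0 hj.le)]
            congr 1
            simp only [hK, hA₁, hA₂]
            ring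
          · simp
      _ ≤ _ := by
          rw [ENNReal.tsum_add, ENNReal.tsum_mul_left, ENNReal.tsum_mul_left, hE,
            ENNReal.ofReal_add (by positivity) (by positivity), ENNReal.ofReal_mul hA₁0,
            ENNReal.ofReal_mul hA₂0]
          gcongr
          · exact hsum B 0 hB le_rfl (by norm_num) 0
          · exact hsum B (1 / 2) hB (by norm_num) (by norm_num) (-p)
  have hbound : ∑' b : Fin 2 → ℤ, ∑' x : Fin 2 → ℤ, ∑' y : Fin 2 → ℤ,
        (if jb b ≤ 3 * B ∧ jb x ≤ 3 * N ∧ jb y ≤ 3 * M ∧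
            |τ * jb b + σ * jb x + σ' * jb y - c (b + (x + y))| ≤ 2
          then w (b + (x + y)) else 0) ≤
      ENNReal.ofReal (E * (C * M ^ (2 + δ - 2))) := by
    calc _ ≤ ∑' b : Fin 2 → ℤ, ∑' p : Fin 2 → ℤ, (if jb b ≤ 9 * B then
          ENNReal.ofReal (K (p - b)) else 0) * (if jb p ≤ 9 * M then w p else 0) := by
          refine ENNReal.tsum_le_tsum fun b => ?_
          by_cases hb : jb b ≤ 3 * B
          · have := tsum_pair_le (M := M) hN hσ hσ' (fun q => c (b + q) - τ * jb b)
              fun q => w (b + q)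
            calc _ = _ := by
                  refine tsum_congr fun x => tsum_congr fun y => if_congr ?_ rfl rfl
                  rw [show τ * jb b + σ * jb x + σ' * jb y - c (b + (x + y))
                    = σ * jb x + σ' * jb y - (c (b + (x + y)) - τ * jb b) by ring]
                  tauto
              _ ≤ _ := this
              _ ≤ _ := by
                  rw [← Equiv.tsum_eq (Equiv.subRight b)]
                  refine ENNReal.tsum_le_tsum fun p => ?_
                  simp only [Equiv.subRight_apply, add_sub_cancel]
                  rw [if_pos (by linarith : jb b ≤ 9 * B)]
                  split_ifs with h1 h2
                  · exact le_rfl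
                  · refine absurd ?_ h2
                    have := jb_add_le b (p - b)
                    rw [add_sub_cancel] at this
                    linarith
                  all_goals exact zero_le
          · refine le_of_eq_of_le ?_ zero_le
            refine ENNReal.tsum_eq_zero.2 fun x => ENNReal.tsum_eq_zero.2 fun y => if_neg ?_
            exact fun h => hb h.1
      _ = ∑' p : Fin 2 → ℤ, (∑' b : Fin 2 → ℤ, (if jb b ≤ 9 * B then
          ENNReal.ofReal (K (p - b)) else 0)) * (if jb p ≤ 9 * M then w p else 0) := by
          rw [ENNReal.tsum_comm]
          exact tsum_congr fun p => ENNReal.tsum_mul_right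
      _ ≤ ∑' p : Fin 2 → ℤ, ENNReal.ofReal E * (if jb p ≤ 9 * M then w p else 0) :=
          ENNReal.tsum_le_tsum fun p => mul_le_mul_left (hinner p) _
      _ ≤ _ := by
          rw [ENNReal.tsum_mul_left, ENNReal.ofReal_mul hE0]
          gcongr
          simpa [hw] using hsum M 2 hM (by norm_num) le_rfl 0
  refine (mul_le_mul_left hbound _).trans ?_
  rw [← ENNReal.ofReal_mul (by positivity)]
  refine ENNReal.ofReal_le_ofReal ?_
  have e1 : N ^ 2 * N ^ (-(1 / 2) : ℝ) * N ^ (-2 + 2 * α) = N ^ (2 * α - 1 / 2) := by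
    rw [sq_mul_rpow hN0, ← Real.rpow_add hN0]; congr 1; ring
  have e2 : N ^ 2 * N ^ (-2 + 2 * α) = N ^ (2 * α) := by
    rw [sq_mul_rpow hN0]; congr 1; ring
  have e3 : B ^ (2 + δ - 0) * B ^ (-2 + 2 * α) = B ^ (2 * α + δ) := by
    rw [← Real.rpow_add hB0]; congr 1; ring
  have e4 : B ^ (2 + δ - 1 / 2) * B ^ (-2 + 2 * α) = B ^ (2 * α - 1 / 2 + δ) := by
    rw [← Real.rpow_add hB0]; congr 1; ring
  have e5 : M ^ (2 + δ - 2) * M ^ (-2 + 2 * α) = M ^ (2 * α - 2 + δ) := by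
    rw [← Real.rpow_add hM0]; congr 1; ring
  have b1 : B ^ (2 * α + δ) * (N ^ (2 * α - 1 / 2) * M ^ (2 * α - 2 + δ)) ≤ M ^ (-δ) := by
    refine (mul_le_mul_of_nonneg_left (rpow_mul_rpow_le hN hNM (g := μ + (2 * α - 2 + δ))
      (by rw [← hμ])) (by positivity)).trans (rpow_mul_rpow_le hB hBM ?_)
    rw [max_eq_left (by linarith)]
    linarith
  have b2 : B ^ (2 * α - 1 / 2 + δ) * (N ^ (2 * α) * M ^ (2 * α - 2 + δ)) ≤ M ^ (-δ) := by
    refine (mul_le_mul_of_nonneg_left (rpow_mul_rpow_le hN hNM (g := 2 * α + (2 * α - 2 + δ))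
      (by rw [max_eq_left (by linarith)])) (by positivity)).trans (rpow_mul_rpow_le hB hBM ?_)
    have : max (2 * α - 1 / 2 + δ) 0 ≤ μ + δ := max_le (by linarith) (by linarith)
    linarith
  calc _ = 193536 * (C * C) * ((B ^ (2 + δ - 0) * B ^ (-2 + 2 * α)) *
          ((N ^ 2 * N ^ (-(1 / 2) : ℝ) * N ^ (-2 + 2 * α)) *
            (M ^ (2 + δ - 2) * M ^ (-2 + 2 * α))) +
        (B ^ (2 + δ - 1 / 2) * B ^ (-2 + 2 * α)) * ((N ^ 2 * N ^ (-2 + 2 * α)) *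
            (M ^ (2 + δ - 2) * M ^ (-2 + 2 * α)))) := by
        rw [hE, hA₁, hA₂]; ring
    _ ≤ 193536 * (C * C) * (M ^ (-δ) + M ^ (-δ)) := by
        rw [e1, e2, e3, e4, e5]
        gcongr
    _ = 387072 * (C * C) * M ^ (-δ) := by ring

open Classical in
/-- The sum over `n₂, n₃, n₄`. -/
theorem exists_triple_bound {α : ℝ} (hα : 0 < α)
    (hα' : 4 * α + max (2 * α - 1 / 2) 0 < 2) :
    ∃ ε C : ℝ, 0 < ε ∧ 0 < C ∧ ∀ B N M : ℝ, 1 ≤ B → 1 ≤ N → 1 ≤ M →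
      ∀ τ σ σ' : ℝ, (τ = -1 ∨ τ = 1) → (σ = -1 ∨ σ = 1) → (σ' = -1 ∨ σ' = 1) →
      ∀ c : (Fin 2 → ℤ) → ℝ,
      (∑' b : Fin 2 → ℤ, ∑' x : Fin 2 → ℤ, ∑' y : Fin 2 → ℤ,
        (if jb b ≤ 3 * B ∧ jb x ≤ 3 * N ∧ jb y ≤ 3 * M ∧
            |τ * jb b + σ * jb x + σ' * jb y - c (b + (x + y))| ≤ 2
          then ENNReal.ofReal (jb (b + (x + y)) ^ (-2 : ℝ)) else 0)) *
        ENNReal.ofReal (B ^ (-2 + 2 * α) * N ^ (-2 + 2 * α) * M ^ (-2 + 2 * α)) ≤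
      ENNReal.ofReal (C * (max B (max N M)) ^ (-ε)) := by
  obtain ⟨ε, C, hε, hC, H⟩ := exists_triple_bound_of_le hα hα'
  refine ⟨ε, C, hε, hC, fun B N M hB hN hM τ σ σ' hτ hσ hσ' c => ?_⟩
  have hmid : ∀ B N M : ℝ, 1 ≤ B → 1 ≤ N → 1 ≤ M → B ≤ N → M ≤ N → ∀ τ σ σ' : ℝ,
      (τ = -1 ∨ τ = 1) → (σ = -1 ∨ σ = 1) → (σ' = -1 ∨ σ' = 1) →
      (∑' b : Fin 2 → ℤ, ∑' x : Fin 2 → ℤ, ∑' y : Fin 2 → ℤ,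
        (if jb b ≤ 3 * B ∧ jb x ≤ 3 * N ∧ jb y ≤ 3 * M ∧
            |τ * jb b + σ * jb x + σ' * jb y - c (b + (x + y))| ≤ 2
          then ENNReal.ofReal (jb (b + (x + y)) ^ (-2 : ℝ)) else 0)) *
        ENNReal.ofReal (B ^ (-2 + 2 * α) * N ^ (-2 + 2 * α) * M ^ (-2 + 2 * α)) ≤
      ENNReal.ofReal (C * N ^ (-ε)) := by
    intro B N M hB hN hM hBN hMN τ σ σ' _ hσ hσ'
    refine le_trans (le_of_eq ?_) (H B M N hB hM hBN hMN τ σ' σ hσ' hσ c)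
    rw [mul_right_comm (B ^ _)]
    congr 1
    refine tsum_congr fun b => ?_
    rw [ENNReal.tsum_comm]
    refine tsum_congr fun y => tsum_congr fun x => ?_
    rw [add_comm y x, add_right_comm (τ * _)]
    exact if_congr (by tauto) rfl rfl
  rcases le_total N M with h1 | h1 <;> rcases le_total B (max N M) with h2 | h2
  · rw [max_eq_right h2, max_eq_right h1]
    rw [max_eq_right h1] at h2
    exact H B N M hB hN h2 h1 τ σ σ' hσ hσ' c
  rotate_left
  · rw [max_eq_right h2, max_eq_left h1]
    rw [max_eq_left h1] at h2
    exact hmid B N M hB hN hM h2 h1 τ σ σ' hτ hσ hσ'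
  all_goals
    rw [max_eq_left h2]
    refine le_trans (le_of_eq ?_) (hmid N B M hN hB hM ((le_max_left _ _).trans h2)
      ((le_max_right _ _).trans h2) σ τ σ' hσ hτ hσ')
    rw [mul_comm (B ^ _)]
    congr 1
    rw [ENNReal.tsum_comm]
    refine tsum_congr fun x => tsum_congr fun b => tsum_congr fun y => ?_
    rw [add_left_comm x b y, add_comm (σ * _)]
    exact if_congr (by tauto) rfl rfl

/-- Quintuples of frequencies, listed in the order `(n₂, n₃, n₄, n₁, n₅)`. -/
def quintupleEquiv (X : Type*) : (X × X × X) × X × X ≃ (Fin 5 → X) where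
  toFun z := ![z.2.1, z.1.1, z.1.2.1, z.1.2.2, z.2.2]
  invFun v := ((v 1, v 2, v 3), v 0, v 4)
  left_inv _ := rfl
  right_inv v := by ext i; fin_cases i <;> rfl

theorem ENNReal.tsum_quintuple {X : Type*} (F : (Fin 5 → X) → ℝ≥0∞) :
    ∑' v, F v = ∑' b, ∑' x, ∑' y, ∑' a, ∑' d, F ![a, b, x, y, d] := by
  rw [← (quintupleEquiv X).tsum_eq, ENNReal.tsum_prod', ENNReal.tsum_prod']
  refine tsum_congr fun b => ?_
  rw [ENNReal.tsum_prod']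
  refine tsum_congr fun x => tsum_congr fun y => ?_
  rw [ENNReal.tsum_prod']
  rfl

theorem ann.jb_rpow_le {N α : ℝ} (hN : 1 ≤ N) (hα0 : 0 ≤ α) (hα : α ≤ 1) {x : Fin 2 → ℤ}
    (h : ann N x) : jb x ^ (-2 + 2 * α) ≤ 4 * N ^ (-2 + 2 * α) := by
  have hN0 : 0 < N := by linarith
  calc jb x ^ (-2 + 2 * α) ≤ (N / 2) ^ (-2 + 2 * α) :=
        Real.rpow_le_rpow_of_nonpos (by linarith) (h.1.trans (znorm_le_jb x)) (by linarith)
    _ = N ^ (-2 + 2 * α) * (2 : ℝ) ^ (2 - 2 * α) := by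
        rw [Real.div_rpow hN0.le (by norm_num), div_eq_mul_inv, ← Real.rpow_neg (by norm_num)]
        congr 2
        ring
    _ ≤ N ^ (-2 + 2 * α) * (2 : ℝ) ^ (2 : ℝ) := by
        gcongr
        · norm_num
        · linarith
    _ = 4 * N ^ (-2 + 2 * α) := by norm_num; ring

theorem tsum_le_of_tsum_ofReal_le {ι : Type*} {f : ι → ℝ} {K : ℝ} (hf : ∀ i, 0 ≤ f i)
    (hK : 0 ≤ K) (h : ∑' i, ENNReal.ofReal (f i) ≤ ENNReal.ofReal K) : ∑' i, f i ≤ K := by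
  refine Real.tsum_le_of_sum_le hf fun S => ?_
  rw [← ENNReal.ofReal_le_ofReal_iff hK, ENNReal.ofReal_sum_of_nonneg fun i _ => hf i]
  exact (ENNReal.sum_le_tsum S).trans h

theorem max_rpow_mul_max_rpow_le {N₁ N₂ N₃ N₄ N₅ ε ε' : ℝ} (h₁ : 1 ≤ N₁) (h₂ : 1 ≤ N₂)
    (hε : 0 < ε) (hε' : 0 < ε') :
    (max N₂ (max N₃ N₄)) ^ (-ε) * (max N₁ N₅) ^ (-ε') ≤
      (max N₁ (max N₂ (max N₃ (max N₄ N₅)))) ^ (-(min ε ε')) := by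
  obtain ⟨A, hA⟩ : ∃ A, A = max N₂ (max N₃ N₄) := ⟨_, rfl⟩
  obtain ⟨B, hB⟩ : ∃ B, B = max N₁ N₅ := ⟨_, rfl⟩
  have hA1 : 1 ≤ A := hA ▸ h₂.trans (le_max_left _ _)
  have hB1 : 1 ≤ B := hB ▸ h₁.trans (le_max_left _ _)
  have hmax : max N₁ (max N₂ (max N₃ (max N₄ N₅))) ≤ A * B := by
    have hA2 : A ≤ A * B := le_mul_of_one_le_right (by linarith) hB1
    have hB2 : B ≤ A * B := le_mul_of_one_le_left (by linarith) hA1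
    have : N₂ ≤ A := hA ▸ le_max_left _ _
    have : N₃ ≤ A := hA ▸ (le_max_left _ _).trans (le_max_right _ _)
    have : N₄ ≤ A := hA ▸ (le_max_right _ _).trans (le_max_right _ _)
    have : N₁ ≤ B := hB ▸ le_max_left _ _
    have : N₅ ≤ B := hB ▸ le_max_right _ _
    simp only [max_le_iff]
    refine ⟨?_, ?_, ?_, ?_, ?_⟩ <;> linarith
  have hm := min_le_left ε ε'
  have hm' := min_le_right ε ε'
  have hm0 : 0 < min ε ε' := lt_min hε hε'
  rw [← hA, ← hB]
  calc A ^ (-ε) * B ^ (-ε') ≤ A ^ (-(min ε ε')) * B ^ (-(min ε ε')) := by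
        gcongr
    _ = (A * B) ^ (-(min ε ε')) := (Real.mul_rpow (by linarith) (by linarith)).symm
    _ ≤ _ := Real.rpow_le_rpow_of_nonpos
        (lt_of_lt_of_le one_pos (h₁.trans (le_max_left _ _))) hmax (by linarith)

open Classical in
/-- The summand is dominated by indicators of `2`-windows for the phase in `n₂, n₃, n₄` and, with
`n₂₃₄` frozen, for the phase in `n₁, n₅`. -/
theorem quintic_summand_le {α s a : ℝ} (hα0 : 0 ≤ α) (hα : α ≤ 1) (ha : 2 * (s - 1) ≤ -a)
    (σ₁₂₃₄₅ σ₂₃₄ : ℝ) (σv : Fin 5 → ℝ) (N : Fin 5 → ℝ) (hN : ∀ j, 1 ≤ N j) (m m' : ℝ)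
    (v : Fin 5 → Fin 2 → ℤ) :
    Set.indicator {v : Fin 5 → Fin 2 → ℤ | (∀ j, ann (N j) (v j)) ∧
          |quinticPhase1 σ₂₃₄ σv v - m| ≤ 1}
        (fun v => jb (sum12345 v) ^ (2 * (s - 1)) * jb (sum234 v) ^ (-2 : ℝ) *
          (∏ j, jb (v j) ^ (-2 + 2 * α)) *
          (Set.indicator
              {w : Fin 5 → Fin 2 → ℤ | |quinticPhase2 σ₁₂₃₄₅ σ₂₃₄ σv w - m'| ≤ 1}
              (fun _ => (1 : ℝ)) v +
            Set.indicator
              {w : Fin 5 → Fin 2 → ℤ | |quinticPhase3 σ₁₂₃₄₅ σ₂₃₄ σv w - m'| ≤ 1}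
              (fun _ => (1 : ℝ)) v)) v ≤
      1024 * (∏ j, N j ^ (-2 + 2 * α)) *
        (if jb (v 1) ≤ 3 * N 1 ∧ jb (v 2) ≤ 3 * N 2 ∧ jb (v 3) ≤ 3 * N 3 ∧
            |σv 1 * jb (v 1) + σv 2 * jb (v 2) + σv 3 * jb (v 3)
              - (m - σ₂₃₄ * jb (v 1 + (v 2 + v 3)))| ≤ 2
          then jb (v 1 + (v 2 + v 3)) ^ (-2 : ℝ) else 0) *
        ((if jb (v 0) ≤ 3 * N 0 ∧ jb (v 4) ≤ 3 * N 4 ∧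
            |σv 0 * jb (v 0) + σv 4 * jb (v 4)
              - (m' - σ₁₂₃₄₅ * jb ((v 1 + (v 2 + v 3)) + (v 0 + v 4))
                - σ₂₃₄ * jb (v 1 + (v 2 + v 3)))| ≤ 2
          then jb ((v 1 + (v 2 + v 3)) + (v 0 + v 4)) ^ (-a) else 0) +
        (if jb (v 0) ≤ 3 * N 0 ∧ jb (v 4) ≤ 3 * N 4 ∧
            |σv 0 * jb (v 0) + σv 4 * jb (v 4)
              - (m' - m - σ₁₂₃₄₅ * jb ((v 1 + (v 2 + v 3)) + (v 0 + v 4)))| ≤ 2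
          then jb ((v 1 + (v 2 + v 3)) + (v 0 + v 4)) ^ (-a) else 0)) := by
  have e1 : sum234 v = v 1 + (v 2 + v 3) := add_assoc _ _ _
  have e2 : sum12345 v = (v 1 + (v 2 + v 3)) + (v 0 + v 4) := by
    simp only [sum12345]; abel
  have hr : ∀ (x : Fin 2 → ℤ) (e : ℝ), 0 ≤ jb x ^ e := fun x e => Real.rpow_nonneg (jb_pos x).le e
  have hNp : 0 ≤ ∏ j, N j ^ (-2 + 2 * α) :=
    Finset.prod_nonneg fun j _ => Real.rpow_nonneg (by linarith [hN j]) _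
  by_cases hv : (∀ j, ann (N j) (v j)) ∧ |quinticPhase1 σ₂₃₄ σv v - m| ≤ 1
  swap
  · rw [Set.indicator_of_notMem (by exact hv)]
    have hite : ∀ (P : Prop) [Decidable P] (x : Fin 2 → ℤ) (e : ℝ), 0 ≤ if P then jb x ^ e else 0 :=
      fun P _ x e => by split_ifs; exacts [hr _ _, le_rfl]
    exact mul_nonneg (mul_nonneg (mul_nonneg (by norm_num) hNp) (hite _ _ _))
      (add_nonneg (hite _ _ _) (hite _ _ _))
  obtain ⟨hann, hph⟩ := hv
  have hjb : ∀ j, jb (v j) ≤ 3 * N j := fun j => (hann j).jb_le (hN j)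
  rw [Set.indicator_of_mem (by exact ⟨hann, hph⟩)]
  simp only [quinticPhase1, e1] at hph
  have hph' := abs_le.1 hph
  rw [if_pos ⟨hjb 1, hjb 2, hjb 3, abs_le.2 ⟨by linarith, by linarith⟩⟩, e1, e2]
  have hprod : ∏ j, jb (v j) ^ (-2 + 2 * α) ≤ 1024 * ∏ j, N j ^ (-2 + 2 * α) := by
    calc _ ≤ ∏ j, 4 * N j ^ (-2 + 2 * α) :=
          Finset.prod_le_prod (fun j _ => hr _ _) fun j _ => (hann j).jb_rpow_le (hN j) hα0 hα
      _ = _ := by rw [Finset.prod_mul_distrib]; norm_num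
  set p := v 1 + (v 2 + v 3) with hp
  set q := v 0 + v 4 with hq
  have hpow : jb (p + q) ^ (2 * (s - 1)) ≤ jb (p + q) ^ (-a) :=
    Real.rpow_le_rpow_of_exponent_le (one_le_jb _) ha
  have hI : ∀ (P Q : (Fin 5 → Fin 2 → ℤ) → Prop) [Decidable (Q v)], (P v → Q v) →
      jb (p + q) ^ (2 * (s - 1)) * Set.indicator {w | P w} (fun _ => (1 : ℝ)) v ≤
        if Q v then jb (p + q) ^ (-a) else 0 := by
    intro P Q _ hPQ
    by_cases h : P v
    · rw [Set.indicator_of_mem (by exact h), if_pos (hPQ h), mul_one]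
      exact hpow
    · rw [Set.indicator_of_notMem (by exact h), mul_zero]
      split_ifs
      exacts [hr _ _, le_rfl]
  have hI2 := hI (fun w => |quinticPhase2 σ₁₂₃₄₅ σ₂₃₄ σv w - m'| ≤ 1)
    (fun v => jb (v 0) ≤ 3 * N 0 ∧ jb (v 4) ≤ 3 * N 4 ∧ |σv 0 * jb (v 0) + σv 4 * jb (v 4)
      - (m' - σ₁₂₃₄₅ * jb (p + q) - σ₂₃₄ * jb p)| ≤ 2) fun h => by
      simp only [quinticPhase2, e1, e2] at h
      have := abs_le.1 h
      exact ⟨hjb 0, hjb 4, abs_le.2 ⟨by linarith, by linarith⟩⟩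
  have hI3 := hI (fun w => |quinticPhase3 σ₁₂₃₄₅ σ₂₃₄ σv w - m'| ≤ 1)
    (fun v => jb (v 0) ≤ 3 * N 0 ∧ jb (v 4) ≤ 3 * N 4 ∧ |σv 0 * jb (v 0) + σv 4 * jb (v 4)
      - (m' - m - σ₁₂₃₄₅ * jb (p + q))| ≤ 2) fun h => by
      simp only [quinticPhase3, e1, e2, Fin.sum_univ_five] at h
      have := abs_le.1 h
      exact ⟨hjb 0, hjb 4, abs_le.2 ⟨by linarith, by linarith⟩⟩
  have hpos : ∀ P : (Fin 5 → Fin 2 → ℤ) → Prop,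
      0 ≤ Set.indicator {w | P w} (fun _ => (1 : ℝ)) v :=
    fun P => Set.indicator_nonneg (fun _ _ => zero_le_one) v
  calc _ = (∏ j, jb (v j) ^ (-2 + 2 * α)) * jb p ^ (-2 : ℝ) *
        (jb (p + q) ^ (2 * (s - 1)) *
          Set.indicator {w | |quinticPhase2 σ₁₂₃₄₅ σ₂₃₄ σv w - m'| ≤ 1} (fun _ => (1 : ℝ)) v +
        jb (p + q) ^ (2 * (s - 1)) *
          Set.indicator {w | |quinticPhase3 σ₁₂₃₄₅ σ₂₃₄ σv w - m'| ≤ 1} (fun _ => (1 : ℝ)) v) := by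
        ring
    _ ≤ _ := by
        refine mul_le_mul (mul_le_mul_of_nonneg_right hprod (hr _ _)) (add_le_add hI2 hI3) ?_ ?_
        · exact add_nonneg (mul_nonneg (hr _ _) (hpos _)) (mul_nonneg (hr _ _) (hpos _))
        · exact mul_nonneg (mul_nonneg (by norm_num) hNp) (hr _ _)

/-- quintic non-resonance sum estimate: if `0 < α < 1/4` and `s < 3/4`, or
`1/4 < α < 5/12` and `s < 5/6 − α`, then there exist `ε > 0` and `C > 0` depending only on
`α, s` such that for all signs, all dyadic `N₁,…,N₅` and all `m, m' ∈ ℤ`,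
`∑_{n₁,…,n₅} ⟨n₁₂₃₄₅⟩^{2(s−1)} ⟨n₂₃₄⟩^{−2} ∏_j 1_{|n_j|∼N_j} ⟨n_j⟩^{−2+2α}
  1_{|φ−m|≤1} (1_{|φ̃−m'|≤1} + 1_{|φ̂−m'|≤1}) ≤ C max(N₁,…,N₅)^{−ε}`. -/
theorem quintic_nonresonance_sum (α s : ℝ)
    (h : (0 < α ∧ α < 1 / 4 ∧ s < 3 / 4) ∨
         (1 / 4 < α ∧ α < 5 / 12 ∧ s < 5 / 6 - α)) :
    ∃ ε C : ℝ, 0 < ε ∧ 0 < C ∧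
      ∀ (σ₁₂₃₄₅ σ₂₃₄ : ℝ) (σv : Fin 5 → ℝ),
        (σ₁₂₃₄₅ = -1 ∨ σ₁₂₃₄₅ = 1) → (σ₂₃₄ = -1 ∨ σ₂₃₄ = 1) →
        (∀ j, σv j = -1 ∨ σv j = 1) →
        ∀ (k : Fin 5 → ℕ) (m m' : ℤ),
          (∑' v : Fin 5 → Fin 2 → ℤ,
            Set.indicator
              {v : Fin 5 → Fin 2 → ℤ |
                (∀ j, ann ((2:ℝ) ^ (k j)) (v j)) ∧
                |quinticPhase1 σ₂₃₄ σv v - (m : ℝ)| ≤ 1}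
              (fun v => jb (sum12345 v) ^ (2 * (s - 1)) * jb (sum234 v) ^ (-2 : ℝ) *
                (∏ j, jb (v j) ^ (-2 + 2 * α)) *
                (Set.indicator
                    {w : Fin 5 → Fin 2 → ℤ | |quinticPhase2 σ₁₂₃₄₅ σ₂₃₄ σv w - (m' : ℝ)| ≤ 1}
                    (fun _ => (1 : ℝ)) v +
                  Set.indicator
                    {w : Fin 5 → Fin 2 → ℤ | |quinticPhase3 σ₁₂₃₄₅ σ₂₃₄ σv w - (m' : ℝ)| ≤ 1}
                    (fun _ => (1 : ℝ)) v)) v) ≤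
            C * (max ((2:ℝ) ^ (k 0)) (max ((2:ℝ) ^ (k 1)) (max ((2:ℝ) ^ (k 2))
                  (max ((2:ℝ) ^ (k 3)) ((2:ℝ) ^ (k 4)))))) ^ (-ε) := by

  classical
  obtain ⟨hα0, hα5, a, ha0, ha, has, hαa⟩ : 0 < α ∧ α < 5 / 12 ∧ ∃ a : ℝ, 0 ≤ a ∧ a ≤ 3 / 2 ∧
      2 * (s - 1) ≤ -a ∧ 2 * α + max (2 * α - 1 / 2) 0 < a := by
    have hmax : ∀ a : ℝ, 2 * α < a → 4 * α - 1 / 2 < a → 2 * α + max (2 * α - 1 / 2) 0 < a := by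
      intro a h1 h2
      rcases max_cases (2 * α - 1 / 2) 0 with ⟨h, -⟩ | ⟨h, -⟩ <;> rw [h] <;> linarith
    have hs := le_max_left s (5 / 12)
    have hs' := le_max_right s (5 / 12)
    rcases h with ⟨h0, h1, h2⟩ | ⟨h0, h1, h2⟩
    · have hlt : max s (5 / 12) < 3 / 4 := max_lt h2 (by norm_num)
      exact ⟨h0, by linarith, 2 * (1 - max s (5 / 12)), by linarith, by linarith, by linarith,
        hmax _ (by linarith) (by linarith)⟩
    · have hlt : max s (5 / 12) < 5 / 6 - α := max_lt h2 (by linarith)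
      exact ⟨by linarith, h1, 2 * (1 - max s (5 / 12)), by linarith, by linarith, by linarith,
        hmax _ (by linarith) (by linarith)⟩
  have hα2 : 4 * α + max (2 * α - 1 / 2) 0 < 2 := by
    rcases max_cases (2 * α - 1 / 2) 0 with ⟨h, -⟩ | ⟨h, -⟩ <;> rw [h] <;> linarith
  obtain ⟨ε₁, C₁, hε₁, hC₁, H₁⟩ := exists_triple_bound hα0 hα2
  obtain ⟨ε₂, C₂, hε₂, hC₂, H₂⟩ := exists_pair_bound ha0 ha hαa
  refine ⟨min ε₁ ε₂, 2048 * (C₁ * C₂), lt_min hε₁ hε₂, by positivity,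
    fun σ₁₂₃₄₅ σ₂₃₄ σv _ _ hσv k m m' => ?_⟩
  obtain ⟨N, hNk⟩ : ∃ N : Fin 5 → ℝ, N = fun j => (2 : ℝ) ^ k j := ⟨_, rfl⟩
  have hN : ∀ j, 1 ≤ N j := fun j => by rw [hNk]; exact one_le_pow₀ one_le_two
  have hN0 : ∀ j, 0 < N j := fun j => one_pos.trans_le (hN j)
  have hNk' : ∀ j, (2 : ℝ) ^ k j = N j := fun j => by rw [hNk]
  simp only [hNk']
  have hM0 : 0 < max (N 0) (max (N 1) (max (N 2) (max (N 3) (N 4)))) :=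
    (hN0 0).trans_le (le_max_left _ _)
  refine tsum_le_of_tsum_ofReal_le (fun v => Set.indicator_nonneg (fun w _ => ?_) v)
    (by positivity) ?_
  · have hr : ∀ (x : Fin 2 → ℤ) (e : ℝ), 0 ≤ jb x ^ e :=
      fun x e => Real.rpow_nonneg (jb_pos x).le e
    exact mul_nonneg (mul_nonneg (mul_nonneg (hr _ _) (hr _ _))
      (Finset.prod_nonneg fun j _ => hr _ _)) (add_nonneg
        (Set.indicator_nonneg (fun _ _ => zero_le_one) _)
        (Set.indicator_nonneg (fun _ _ => zero_le_one) _))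
  set β := -2 + 2 * α with hβ
  set G : ((Fin 2 → ℤ) → ℝ) → (Fin 2 → ℤ) → (Fin 2 → ℤ) → (Fin 2 → ℤ) → ℝ≥0∞ :=
    fun c p x y => if jb x ≤ 3 * N 0 ∧ jb y ≤ 3 * N 4 ∧
      |σv 0 * jb x + σv 4 * jb y - c (x + y)| ≤ 2
      then ENNReal.ofReal (jb (p + (x + y)) ^ (-a)) else 0 with hG
  set F : (Fin 2 → ℤ) → (Fin 2 → ℤ) → (Fin 2 → ℤ) → ℝ≥0∞ :=
    fun b x y => if jb b ≤ 3 * N 1 ∧ jb x ≤ 3 * N 2 ∧ jb y ≤ 3 * N 3 ∧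
      |σv 1 * jb b + σv 2 * jb x + σv 3 * jb y - (m - σ₂₃₄ * jb (b + (x + y)))| ≤ 2
      then ENNReal.ofReal (jb (b + (x + y)) ^ (-2 : ℝ)) else 0 with hF
  set c₂ : (Fin 2 → ℤ) → (Fin 2 → ℤ) → ℝ :=
    fun p q => m' - σ₁₂₃₄₅ * jb (p + q) - σ₂₃₄ * jb p with hc₂
  set c₃ : (Fin 2 → ℤ) → (Fin 2 → ℤ) → ℝ := fun p q => m' - m - σ₁₂₃₄₅ * jb (p + q) with hc₃
  set P₁ : ℝ := N 1 ^ β * N 2 ^ β * N 3 ^ β with hP₁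
  set P₂ : ℝ := N 0 ^ β * N 4 ^ β with hP₂
  have hpow : ∀ j, 0 ≤ N j ^ β := fun j => Real.rpow_nonneg (hN0 j).le _
  have hP₁0 : 0 ≤ P₁ := mul_nonneg (mul_nonneg (hpow 1) (hpow 2)) (hpow 3)
  have hP₂0 : 0 ≤ P₂ := mul_nonneg (hpow 0) (hpow 4)
  obtain ⟨K₂, hK₂⟩ : ∃ K, K = C₂ * (max (N 0) (N 4)) ^ (-ε₂) := ⟨_, rfl⟩
  have hm04 : 0 < max (N 0) (N 4) := (hN0 0).trans_le (le_max_left _ _)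
  have hK₂0 : 0 ≤ K₂ := by rw [hK₂]; positivity
  have hpair : ∀ c p, (∑' x, ∑' y, G c p x y) * ENNReal.ofReal P₂ ≤ ENNReal.ofReal K₂ :=
    fun c p => hK₂ ▸ H₂ (N 0) (N 4) (hN 0) (hN 4) (σv 0) (σv 4) (hσv 0) (hσv 4) p c
  have htriple := H₁ (N 1) (N 2) (N 3) (hN 1) (hN 2) (hN 3) (σv 1) (σv 2) (σv 3) (hσv 1) (hσv 2)
    (hσv 3) fun p => m - σ₂₃₄ * jb p
  rw [ENNReal.tsum_quintuple]
  calc _ ≤ ∑' b, ∑' x, ∑' y, ∑' a', ∑' d, ENNReal.ofReal 1024 * ENNReal.ofReal P₁ *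
        ENNReal.ofReal P₂ * F b x y *
          (G (c₂ (b + (x + y))) (b + (x + y)) a' d + G (c₃ (b + (x + y))) (b + (x + y)) a' d) := by
        refine ENNReal.tsum_le_tsum fun b => ENNReal.tsum_le_tsum fun x =>
          ENNReal.tsum_le_tsum fun y => ENNReal.tsum_le_tsum fun a' =>
          ENNReal.tsum_le_tsum fun d => ?_
        refine (ENNReal.ofReal_le_ofReal (quintic_summand_le hα0.le (by linarith) has σ₁₂₃₄₅ σ₂₃₄ σv
          N hN m m' ![a', b, x, y, d])).trans (le_of_eq ?_)
        have hofite : ∀ (P : Prop) [Decidable P] (z : ℝ), ENNReal.ofReal (if P then z else 0) =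
            if P then ENNReal.ofReal z else 0 := fun P _ z => by split_ifs <;> simp
        have hite : ∀ (P : Prop) [Decidable P] (z : Fin 2 → ℤ) (e : ℝ),
            0 ≤ if P then jb z ^ e else 0 :=
          fun P _ z e => by split_ifs; exacts [Real.rpow_nonneg (jb_pos z).le e, le_rfl]
        have hprod : ∏ j, N j ^ β = P₁ * P₂ := by
          rw [Fin.prod_univ_five, hP₁, hP₂]; ring
        rw [← hβ, hprod, ENNReal.ofReal_mul (mul_nonneg (by positivity) (hite _ _ _)),
          ENNReal.ofReal_mul (by positivity), ENNReal.ofReal_add (hite _ _ _) (hite _ _ _),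
          ENNReal.ofReal_mul (by norm_num), ENNReal.ofReal_mul hP₁0, hofite, hofite, hofite,
          ← mul_assoc]
        rfl
    _ = ∑' b, ∑' x, ∑' y, ENNReal.ofReal 1024 * ENNReal.ofReal P₁ * F b x y *
          ((∑' a', ∑' d, G (c₂ (b + (x + y))) (b + (x + y)) a' d) * ENNReal.ofReal P₂ +
            (∑' a', ∑' d, G (c₃ (b + (x + y))) (b + (x + y)) a' d) * ENNReal.ofReal P₂) := by
        refine tsum_congr fun b => tsum_congr fun x => tsum_congr fun y => ?_
        simp_rw [ENNReal.tsum_mul_left, ENNReal.tsum_add]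
        ring
    _ ≤ ∑' b, ∑' x, ∑' y, ENNReal.ofReal 1024 * ENNReal.ofReal P₁ * F b x y *
          (ENNReal.ofReal K₂ + ENNReal.ofReal K₂) := by
        gcongr
        · exact hpair _ _
        · exact hpair _ _
    _ = ENNReal.ofReal 1024 * ((∑' b, ∑' x, ∑' y, F b x y) * ENNReal.ofReal P₁) *
          (ENNReal.ofReal K₂ + ENNReal.ofReal K₂) := by
        simp_rw [ENNReal.tsum_mul_right, ENNReal.tsum_mul_left]
        ring
    _ ≤ ENNReal.ofReal 1024 *
          ENNReal.ofReal (C₁ * (max (N 1) (max (N 2) (N 3))) ^ (-ε₁)) *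
          (ENNReal.ofReal K₂ + ENNReal.ofReal K₂) := by
        gcongr
    _ ≤ _ := by
        have hm : 0 < max (N 1) (max (N 2) (N 3)) := (hN0 1).trans_le (le_max_left _ _)
        rw [← ENNReal.ofReal_add hK₂0 hK₂0, ← ENNReal.ofReal_mul (by norm_num),
          ← ENNReal.ofReal_mul (by positivity)]
        refine ENNReal.ofReal_le_ofReal ?_
        have := max_rpow_mul_max_rpow_le (N₃ := N 2) (N₄ := N 3) (N₅ := N 4) (hN 0) (hN 1) hε₁ hε₂
        have := mul_le_mul_of_nonneg_left this (by positivity : 0 ≤ 2048 * (C₁ * C₂))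
        rw [hK₂]
        linarith
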